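/- (Theorem 3) Let d ≥ 2, N ≥ 2, f ∈ F⁺_sc, and let ρ be any state on ℂ^d (positive semidefinite, trace 1). Let U = Σ_{i=0}^{d−1} |i⟩⟨i| ⊗ σ_i^{⊗(N−1)} on (ℂ^d)^{⊗N}, where σ_0 = I_d and σ_i (i ≠ 0) is the permutation matrix exchanging |0⟩ and |i⟩, and set ρ' = U(ρ ⊗ (|0⟩⟨0|)^{⊗(N−1)})Uᴴ. Then E^f_GME(ρ') = G^f_GME(ρ') = C_f(ρ). -/

import Mathlib

open scoped BigOperators
open Matrix
open scoped ComplexOrder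

/-- A symmetric concave function on finite probability vectors, invariant under
appending zero entries: the class `F_sc` of \cite{HZ,SD}. -/
structure SymmConcave where
  f : ∀ n : ℕ, (Fin n → ℝ) → ℝ
  symm : ∀ (n : ℕ) (π : Equiv.Perm (Fin n)) (p : Fin n → ℝ), f n (p ∘ π) = f n p
  concave : ∀ n : ℕ,
    ConcaveOn ℝ {p : Fin n → ℝ | (∀ i, 0 ≤ p i) ∧ ∑ i, p i = 1} (f n)
  zeroPad : ∀ (n : ℕ) (p : Fin n → ℝ), f (n + 1) (Fin.snoc p 0) = f n p

/-- The class `F⁺_sc`: in addition, on probability vectors, `f p = 0` iff some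
entry of `p` equals `1`. -/
def SymmConcave.IsPos (F : SymmConcave) : Prop :=
  ∀ (n : ℕ) (p : Fin n → ℝ), (∀ i, 0 ≤ p i) → ∑ i, p i = 1 →
    (F.f n p = 0 ↔ ∃ i, p i = 1)

/-- Combine an assignment of indices on `γ` and one on `γᶜ` into a global index. -/
def mergeIdx {N : ℕ} {dims : Fin N → ℕ} (γ : Finset (Fin N))
    (a : ∀ i : {i // i ∈ γ}, Fin (dims i.1))
    (b : ∀ i : {i // i ∈ γᶜ}, Fin (dims i.1)) : ∀ i, Fin (dims i) := fun i =>
  if h : i ∈ γ then a ⟨i, h⟩ else b ⟨i, Finset.mem_compl.mpr h⟩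

/-- The reduced density matrix of the pure state `ψ` on the parties in `γ`
(the parties in `γᶜ` are traced out). -/
noncomputable def reducedMat {N : ℕ} {dims : Fin N → ℕ} (γ : Finset (Fin N))
    (ψ : (∀ i, Fin (dims i)) → ℂ) :
    Matrix (∀ i : {i // i ∈ γ}, Fin (dims i.1)) (∀ i : {i // i ∈ γ}, Fin (dims i.1)) ℂ :=
  Matrix.of fun a a' => ∑ b : ∀ i : {i // i ∈ γᶜ}, Fin (dims i.1),
    ψ (mergeIdx γ a b) * star (ψ (mergeIdx γ a' b))

open scoped Classical in
/-- `f` evaluated on the Schmidt vector of `ψ` across the bipartition `γ|γᶜ`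
(i.e. on the eigenvalues of the reduced density matrix on `γ`). -/
noncomputable def schmidtVal {N : ℕ} {dims : Fin N → ℕ} (F : SymmConcave)
    (γ : Finset (Fin N)) (ψ : (∀ i, Fin (dims i)) → ℂ) : ℝ :=
  if h : (reducedMat γ ψ).IsHermitian then
    F.f (Fintype.card (∀ i : {i // i ∈ γ}, Fin (dims i.1)))
      (fun k => h.eigenvalues ((Fintype.equivFin _).symm k))
  else 0

/-- All nonempty proper subsets of the parties.  Each bipartition `γ|γ̄` occurs
here as both `γ` and `γ̄`, with equal associated Schmidt values. -/
def bips (N : ℕ) : Finset (Finset (Fin N)) :=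
  Finset.univ.filter fun γ => γ.Nonempty ∧ γ ≠ Finset.univ

/-- min-GME measure of a pure state: minimum of `f` of the Schmidt vector over
all bipartitions. -/
noncomputable def EGMEp {N : ℕ} {dims : Fin N → ℕ} (F : SymmConcave)
    (ψ : (∀ i, Fin (dims i)) → ℂ) : ℝ :=
  sInf {x | ∃ γ ∈ bips N, x = schmidtVal F γ ψ}

/-- geo-GME measure of a pure state: geometric mean of `f` of the Schmidt
vectors over all bipartitions. -/
noncomputable def GGMEp {N : ℕ} {dims : Fin N → ℕ} (F : SymmConcave)
    (ψ : (∀ i, Fin (dims i)) → ℂ) : ℝ :=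
  (∏ γ ∈ bips N, schmidtVal F γ ψ) ^ (((bips N).card : ℝ))⁻¹

/-- Convex roof extension of a pure-state functional `E` to mixed states:
the infimum of `∑_k p_k E(ψ_k)` over all finite decompositions
`ρ = ∑_k p_k |ψ_k⟩⟨ψ_k|` into pure (unit-vector) states with `p_k > 0`. -/
noncomputable def convexRoof {ι : Type*} [Fintype ι] (E : (ι → ℂ) → ℝ)
    (ρ : Matrix ι ι ℂ) : ℝ :=
  sInf {x | ∃ (K : ℕ) (p : Fin K → ℝ) (ψ : Fin K → ι → ℂ),
    (∀ k, 0 < p k) ∧ (∀ k, ∑ t, ‖ψ k t‖ ^ 2 = 1) ∧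
    ρ = ∑ k, (Matrix.of fun t s => ((p k : ℂ)) * (ψ k t * star (ψ k s)) : Matrix ι ι ℂ) ∧
    x = ∑ k, p k * E (ψ k)}

/-- A pure state is biseparable if it factorizes across some bipartition. -/
def PureBisep {N : ℕ} {dims : Fin N → ℕ} (ψ : (∀ i, Fin (dims i)) → ℂ) : Prop :=
  ∃ γ ∈ bips N, ∃ (φ : (∀ i : {i // i ∈ γ}, Fin (dims i.1)) → ℂ)
    (χ : (∀ i : {i // i ∈ γᶜ}, Fin (dims i.1)) → ℂ),
    ∀ a b, ψ (mergeIdx γ a b) = φ a * χ b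

/-- A mixed state is biseparable if it is a finite convex combination of
biseparable pure states. -/
def MixedBisep {N : ℕ} {dims : Fin N → ℕ}
    (ρ : Matrix (∀ i, Fin (dims i)) (∀ i, Fin (dims i)) ℂ) : Prop :=
  ∃ (K : ℕ) (q : Fin K → ℝ) (ψ : Fin K → (∀ i, Fin (dims i)) → ℂ),
    (∀ k, 0 ≤ q k) ∧ (∑ k, q k = 1) ∧ (∀ k, ∑ t, ‖ψ k t‖ ^ 2 = 1) ∧
    (∀ k, PureBisep (ψ k)) ∧
    ρ = ∑ k, (Matrix.of fun t s => ((q k : ℂ)) * (ψ k t * star (ψ k s)) :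
      Matrix (∀ i, Fin (dims i)) (∀ i, Fin (dims i)) ℂ)

/-- The coherence measure `C_f` of a state on `ℂ^d`, defined by the convex roof
of `|ψ⟩ = ∑_j c_j |j⟩ ↦ f(|c₀|², …, |c_{d-1}|²)`. -/
noncomputable def coherenceMeasure (F : SymmConcave) {d : ℕ}
    (ρ : Matrix (Fin d) (Fin d) ℂ) : ℝ :=
  convexRoof (fun v => F.f d fun j => ‖v j‖ ^ 2) ρ

/-- Extending a family along an injection by zeros adds zeros to its multiset of values. -/
lemma map_univ_eq_add_replicate_zero {ι κ : Type*} [Fintype ι] [Fintype κ]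
    {e : ι → κ} (he : Function.Injective e) (q : ι → ℝ) (g : κ → ℝ)
    (hg : ∀ i, g (e i) = q i) (hg0 : ∀ t, t ∉ Set.range e → g t = 0) :
    (Finset.univ : Finset κ).val.map g =
      (Finset.univ : Finset ι).val.map q +
        Multiset.replicate (Fintype.card κ - Fintype.card ι) 0 := by
  classical
  have hsplit : (Finset.univ : Finset κ).val =
      (Finset.univ.map ⟨e, he⟩).val + (Finset.univ.map ⟨e, he⟩)ᶜ.val := by
    rw [← Finset.disjUnion_val _ _ disjoint_compl_right]
    congr 1
    simp
  rw [hsplit, Multiset.map_add]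
  congr 1
  · rw [Finset.map_val, Multiset.map_map]
    exact Multiset.map_congr rfl fun i _ => hg i
  · rw [Multiset.map_congr rfl (g := fun _ => (0 : ℝ)), Multiset.map_const']
    · rw [Finset.card_val, Finset.card_compl, Finset.card_map, Finset.card_univ]
    · intro t ht
      apply hg0
      simpa using ht

namespace SymmConcave

variable (F : SymmConcave)

lemma f_eq_of_map_univ_eq {n : ℕ} {p q : Fin n → ℝ}
    (h : (Finset.univ : Finset (Fin n)).val.map p = Finset.univ.val.map q) :
    F.f n p = F.f n q := by
  have hfib : ∀ c, Nonempty ({i // p i = c} ≃ {i // q i = c}) := by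
    intro c
    rw [← Fintype.card_eq, Fintype.card_subtype, Fintype.card_subtype]
    have hc := congrArg (Multiset.count c) h
    rw [Multiset.count_map, Multiset.count_map] at hc
    simpa only [Finset.card_def, Finset.filter_val, eq_comm] using hc
  let e := fun c => (hfib c).some
  rw [← F.symm n (Equiv.ofFiberEquiv e) q]
  congr 1
  funext i
  exact (Equiv.ofFiberEquiv_map e i).symm

lemma f_pad {m n : ℕ} (hmn : m ≤ n) (q : Fin m → ℝ) :
    F.f n (fun i => if h : (i : ℕ) < m then q ⟨i, h⟩ else 0) = F.f m q := by
  induction n, hmn using Nat.le_induction with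
  | base => simp
  | succ n hmn ih =>
    rw [← ih, ← F.zeroPad n]
    refine congrArg (F.f (n + 1)) ?_
    funext i
    refine Fin.lastCases ?_ (fun j => ?_) i
    · simp [hmn]
    · simp

lemma f_eq_of_map_univ_eq_add_replicate {m n : ℕ} {p : Fin n → ℝ} {q : Fin m → ℝ}
    (hmn : m ≤ n)
    (h : (Finset.univ : Finset (Fin n)).val.map p =
      (Finset.univ : Finset (Fin m)).val.map q + Multiset.replicate (n - m) 0) :
    F.f n p = F.f m q := by
  rw [← F.f_pad hmn q]
  apply F.f_eq_of_map_univ_eq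
  rw [h, map_univ_eq_add_replicate_zero (Fin.castLE_injective hmn) q]
  · simp
  · intro i
    simp
  · intro t ht
    rw [dif_neg]
    intro htm
    exact ht ⟨⟨t, htm⟩, rfl⟩

lemma f_nonneg (hF : F.IsPos) {n : ℕ} {p : Fin n → ℝ} (hp : ∀ i, 0 ≤ p i)
    (hp1 : ∑ i, p i = 1) : 0 ≤ F.f n p := by
  have hmem : ∀ i ∈ (Finset.univ : Finset (Fin n)), (Pi.single i 1 : Fin n → ℝ) ∈
      {p : Fin n → ℝ | (∀ i, 0 ≤ p i) ∧ ∑ i, p i = 1} := by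
    intro i _
    refine ⟨fun j => ?_, by simp⟩
    by_cases hij : j = i
    · subst hij; simp
    · simp [hij]
  have h := (F.concave n).le_map_sum (fun i _ => hp i) hp1 hmem
  have h0 : ∀ i : Fin n, F.f n (Pi.single i 1) = 0 := fun i =>
    (hF n _ (hmem i (Finset.mem_univ i)).1 (hmem i (Finset.mem_univ i)).2).2 ⟨i, by simp⟩
  have hsum : ∑ i, p i • (Pi.single i 1 : Fin n → ℝ) = p := by
    funext j
    simp [Finset.sum_apply, Pi.single_apply]
  rw [hsum] at h
  simpa [h0] using h

end SymmConcave

/-- The eigenvalues of a real diagonal matrix are its diagonal entries, as a multiset. -/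
lemma map_eigenvalues_diagonal {κ : Type*} [Fintype κ] [DecidableEq κ] (g : κ → ℝ)
    {A : Matrix κ κ ℂ} (hA : A.IsHermitian)
    (hd : A = Matrix.diagonal fun a => (g a : ℂ)) :
    Finset.univ.val.map hA.eigenvalues = Finset.univ.val.map g := by
  have h := hA.roots_charpoly_eq_eigenvalues
  have hchar : A.charpoly.roots = Finset.univ.val.map fun a => (g a : ℂ) := by
    rw [hd, Matrix.charpoly_diagonal, ← Polynomial.roots_multiset_prod_X_sub_C
      (Finset.univ.val.map fun a => (g a : ℂ)), Multiset.map_map]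
    rfl
  rw [hchar] at h
  have h' := congrArg (Multiset.map Complex.re) h
  simpa [Multiset.map_map, Function.comp_def] using h'.symm

lemma mergeIdx_eq_const {N d : ℕ} {γ : Finset (Fin N)}
    (a : {i // i ∈ γ} → Fin d) (b : {i // i ∈ γᶜ} → Fin d) (i : Fin d) :
    mergeIdx (dims := fun _ => d) γ a b = (fun _ => i) ↔ (a = fun _ => i) ∧ b = fun _ => i := by
  constructor
  · intro h
    constructor
    · funext x
      have := congrFun h x.1
      simpa [mergeIdx, x.2] using this
    · funext x
      have := congrFun h x.1
      simpa [mergeIdx, Finset.mem_compl.1 x.2] using this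
  · rintro ⟨rfl, rfl⟩
    funext x
    by_cases hx : x ∈ γ <;> simp [mergeIdx, hx]

/-- The function on tuples equal to `φ i` at the constant tuple `i` and zero at nonconstant
tuples; for complex `φ` this is the state `∑ i, φ i |i, …, i⟩`. -/
noncomputable def ghz {α ι M : Type*} [Zero M] (φ : ι → M) : (α → ι) → M :=
  Function.extend (fun i _ => i) φ 0

lemma const_injective {α ι : Type*} [Nonempty α] :
    Function.Injective (fun (i : ι) (_ : α) => i) := fun _ _ h =>
  congrFun h (Classical.arbitrary α)

lemma ghz_const {α ι M : Type*} [Zero M] [Nonempty α] (φ : ι → M) (i : ι) :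
    ghz φ (fun _ : α => i) = φ i :=
  const_injective.extend_apply φ 0 i

lemma ghz_of_forall_ne {α ι M : Type*} [Zero M] (φ : ι → M) (t : α → ι)
    (ht : ∀ i : ι, t ≠ fun _ => i) : ghz φ t = 0 :=
  Function.extend_apply' _ _ _ fun ⟨i, hi⟩ => ht i hi.symm

lemma reducedMat_ghz {N d : ℕ} {γ : Finset (Fin N)} (hγ : γ ∈ bips N) (φ : Fin d → ℂ) :
    reducedMat (dims := fun _ => d) γ (ghz φ) = Matrix.diagonal fun a =>
      ((ghz (fun i => ‖φ i‖ ^ 2) a : ℝ) : ℂ) := by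
  obtain ⟨-, ⟨x, hx⟩, hne⟩ := Finset.mem_filter.1 hγ
  have : Nonempty {i // i ∈ γ} := ⟨⟨x, hx⟩⟩
  have : Nonempty {i // i ∈ γᶜ} := by
    obtain ⟨y, hy⟩ := Finset.compl_ne_univ_iff_nonempty γᶜ |>.1 (by simpa using hne)
    exact ⟨⟨y, hy⟩⟩
  have : Nonempty (Fin N) := ⟨x⟩
  ext a a'
  rw [reducedMat, Matrix.of_apply]
  by_cases ha : ∃ i, a = fun _ => i
  · obtain ⟨i, rfl⟩ := ha
    have hother : ∀ b : {i // i ∈ γᶜ} → Fin d, b ≠ (fun _ => i) →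
        ghz φ (mergeIdx (dims := fun _ => d) γ (fun _ => i) b) = 0 := by
      intro b hb
      refine ghz_of_forall_ne _ _ fun j hj => hb ?_
      obtain ⟨h1, h2⟩ := (mergeIdx_eq_const _ _ _).1 hj
      have : i = j := const_injective h1
      rw [h2, this]
    rw [Finset.sum_eq_single (fun _ => i)]
    · rw [(mergeIdx_eq_const (d := d) (γ := γ) (fun _ => i) (fun _ => i) i).2 ⟨rfl, rfl⟩,
        ghz_const]
      by_cases ha' : a' = fun _ => i
      · subst ha'
        rw [(mergeIdx_eq_const (d := d) (γ := γ) (fun _ => i) (fun _ => i) i).2 ⟨rfl, rfl⟩,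
          ghz_const, Matrix.diagonal_apply_eq, ghz_const]
        simpa using Complex.mul_conj' (φ i)
      · rw [Matrix.diagonal_apply_ne _ (Ne.symm ha'), ghz_of_forall_ne]
        · simp
        · intro j hj
          obtain ⟨h1, h2⟩ := (mergeIdx_eq_const _ _ _).1 hj
          have : i = j := const_injective h2
          exact ha' (by rw [h1, this])
    · intro b _ hb
      rw [hother b hb, zero_mul]
    · simp
  · push Not at ha
    rw [Finset.sum_eq_zero]
    · by_cases haa : a = a'
      · subst haa
        rw [Matrix.diagonal_apply_eq, ghz_of_forall_ne _ _ ha, Complex.ofReal_zero]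
      · rw [Matrix.diagonal_apply_ne _ haa]
    · intro b _
      rw [ghz_of_forall_ne, zero_mul]
      intro j hj
      exact ha j ((mergeIdx_eq_const _ _ _).1 hj).1

lemma schmidtVal_ghz {N d : ℕ} (F : SymmConcave) {γ : Finset (Fin N)} (hγ : γ ∈ bips N)
    (φ : Fin d → ℂ) :
    schmidtVal (dims := fun _ => d) F γ (ghz φ) = F.f d fun j => ‖φ j‖ ^ 2 := by
  have hdiag := reducedMat_ghz hγ φ
  have hherm : (reducedMat (dims := fun _ => d) γ (ghz φ)).IsHermitian := by
    rw [hdiag]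
    apply Matrix.isHermitian_diagonal_of_self_adjoint
    ext a
    simp
  obtain ⟨x, hx⟩ := (Finset.mem_filter.1 hγ).2.1
  have : Nonempty {i // i ∈ γ} := ⟨⟨x, hx⟩⟩
  have hinj : Function.Injective (fun (i : Fin d) (_ : {i // i ∈ γ}) => i) := const_injective
  rw [schmidtVal, dif_pos hherm]
  refine F.f_eq_of_map_univ_eq_add_replicate
    (by simpa using Fintype.card_le_of_injective _ hinj) ?_
  have hmap := map_eigenvalues_diagonal _ hherm (by convert hdiag)
  have hpad := map_univ_eq_add_replicate_zero hinj (fun j => ‖φ j‖ ^ 2) _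
    (ghz_const fun j => ‖φ j‖ ^ 2)
    (fun t ht => ghz_of_forall_ne (fun j => ‖φ j‖ ^ 2) t fun i h => ht ⟨i, h.symm⟩)
  rw [hpad, Fintype.card_fin] at hmap
  rw [← hmap]
  rw [← Multiset.map_univ_val_equiv (Fintype.equivFin ({i // i ∈ γ} → Fin d)).symm,
    Multiset.map_map]
  rfl

lemma bips_nonempty {N : ℕ} (hN : 2 ≤ N) : (bips N).Nonempty := by
  refine ⟨{⟨0, by omega⟩}, Finset.mem_filter.2 ⟨Finset.mem_univ _, by simp, fun h => ?_⟩⟩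
  have := congrArg Finset.card h
  simp at this
  omega

lemma EGMEp_ghz {N d : ℕ} (hN : 2 ≤ N) (F : SymmConcave) (φ : Fin d → ℂ) :
    EGMEp (dims := fun _ : Fin N => d) F (ghz φ) = F.f d fun j => ‖φ j‖ ^ 2 := by
  have hset : {x | ∃ γ ∈ bips N, x = schmidtVal (dims := fun _ => d) F γ (ghz φ)} =
      {F.f d fun j => ‖φ j‖ ^ 2} := by
    ext x
    constructor
    · rintro ⟨γ, hγ, rfl⟩
      exact schmidtVal_ghz F hγ φ
    · rintro rfl
      obtain ⟨γ, hγ⟩ := bips_nonempty hN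
      exact ⟨γ, hγ, (schmidtVal_ghz F hγ φ).symm⟩
  rw [EGMEp, hset, csInf_singleton]

lemma GGMEp_ghz {N d : ℕ} (hN : 2 ≤ N) (F : SymmConcave) (hF : F.IsPos) (φ : Fin d → ℂ)
    (hφ : ∑ j, ‖φ j‖ ^ 2 = 1) :
    GGMEp (dims := fun _ : Fin N => d) F (ghz φ) = F.f d fun j => ‖φ j‖ ^ 2 := by
  rw [GGMEp, Finset.prod_congr rfl fun γ hγ => schmidtVal_ghz F hγ φ, Finset.prod_const]
  exact Real.pow_rpow_inv_natCast (F.f_nonneg hF (fun j => by positivity) hφ)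
    (bips_nonempty hN).card_pos.ne'

lemma apply_eq_zero_of_decomposition {κ : Type*} {ρ : Matrix κ κ ℂ} {K : ℕ}
    {p : Fin K → ℝ} {ψ : Fin K → κ → ℂ} (hp : ∀ k, 0 < p k)
    (hρ : ρ = ∑ k, (Matrix.of fun t s => ((p k : ℂ)) * (ψ k t * star (ψ k s)) : Matrix κ κ ℂ))
    {t : κ} (ht : ρ t t = 0) (k : Fin K) : ψ k t = 0 := by
  have h : ∑ k, p k * ‖ψ k t‖ ^ 2 = 0 := by
    have h1 : ((∑ k, p k * ‖ψ k t‖ ^ 2 : ℝ) : ℂ) = 0 := by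
      rw [← ht, hρ, Matrix.sum_apply]
      push_cast
      refine Finset.sum_congr rfl fun k _ => ?_
      rw [Matrix.of_apply, ← Complex.mul_conj']
      rfl
    exact_mod_cast h1
  rw [Finset.sum_eq_zero_iff_of_nonneg fun k _ => mul_nonneg (hp k).le (by positivity)] at h
  simpa [(hp k).ne'] using h k (Finset.mem_univ k)

/-- Embedding a state along an injection of the basis preserves a convex roof, provided the
pure-state functionals agree on embedded unit vectors. -/
lemma convexRoof_extend {ι κ : Type*} [Fintype ι] [Fintype κ] {c : ι → κ}
    (hc : Function.Injective c) {E : (κ → ℂ) → ℝ} {E' : (ι → ℂ) → ℝ}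
    {ρ' : Matrix κ κ ℂ} {ρ : Matrix ι ι ℂ}
    (hE : ∀ φ : ι → ℂ, ∑ i, ‖φ i‖ ^ 2 = 1 → E (Function.extend c φ 0) = E' φ)
    (hρ : ∀ i j, ρ' (c i) (c j) = ρ i j)
    (hl : ∀ t s, t ∉ Set.range c → ρ' t s = 0) (hr : ∀ t s, s ∉ Set.range c → ρ' t s = 0) :
    convexRoof E ρ' = convexRoof E' ρ := by
  have hnorm : ∀ φ : ι → ℂ, ∑ t, ‖Function.extend c φ 0 t‖ ^ 2 = ∑ i, ‖φ i‖ ^ 2 := by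
    intro φ
    refine (Fintype.sum_of_injective c hc _ _ (fun t ht => ?_) fun i => ?_).symm
    · rw [Function.extend_apply' _ _ _ ht]
      simp
    · rw [hc.extend_apply]
  unfold convexRoof
  congr 1
  ext x
  constructor
  · rintro ⟨K, p, ψ, hp, hψ, hdec, rfl⟩
    have hext : ∀ k, Function.extend c (fun i => ψ k (c i)) 0 = ψ k := by
      intro k
      funext t
      by_cases ht : t ∈ Set.range c
      · obtain ⟨i, rfl⟩ := ht
        rw [hc.extend_apply]
      · rw [Function.extend_apply' _ _ _ ht,
          apply_eq_zero_of_decomposition hp hdec (hl t t ht) k]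
        rfl
    have hunit : ∀ k, ∑ i, ‖ψ k (c i)‖ ^ 2 = 1 := by
      intro k
      rw [← hnorm (fun i => ψ k (c i)), hext]
      exact hψ k
    refine ⟨K, p, fun k i => ψ k (c i), hp, hunit, ?_, ?_⟩
    · ext i j
      rw [← hρ, hdec]
      simp [Matrix.sum_apply]
    · refine Finset.sum_congr rfl fun k _ => ?_
      rw [← hE _ (hunit k), hext]
  · rintro ⟨K, p, φ, hp, hφ, hdec, rfl⟩
    refine ⟨K, p, fun k => Function.extend c (φ k) 0, hp,
      fun k => (hnorm _).trans (hφ k), ?_, ?_⟩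
    · ext t s
      rw [Matrix.sum_apply]
      by_cases ht : t ∈ Set.range c
      · by_cases hs : s ∈ Set.range c
        · obtain ⟨i, rfl⟩ := ht
          obtain ⟨j, rfl⟩ := hs
          rw [hρ, hdec, Matrix.sum_apply]
          simp only [Matrix.of_apply, hc.extend_apply]
        · rw [hr t s hs]
          simp [Function.extend_apply' _ _ _ hs]
      · rw [hl t s ht]
        simp [Function.extend_apply' _ _ _ ht]
    · exact Finset.sum_congr rfl fun k _ => by rw [hE _ (hφ k)]

/-- Preparing the ancillas in `|z⟩` and applying the controlled swaps sends `|i⟩` to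
`|i, …, i⟩`. -/
lemma controlledSwap_conj {N d : ℕ} (z : Fin d) (i₀ : Fin N)
    (ρ : Matrix (Fin d) (Fin d) ℂ) (W : Matrix (Fin N → Fin d) (Fin d) ℂ)
    (hW : W = Matrix.of fun t i => if t = (fun _ => i) then 1 else 0) :
    (Matrix.of fun t s : Fin N → Fin d =>
        if t i₀ = s i₀ ∧ ∀ i, i ≠ i₀ → t i = Equiv.swap z (s i₀) (s i) then (1 : ℂ) else 0) *
      (Matrix.of fun t s : Fin N → Fin d =>
        if (∀ i, i ≠ i₀ → t i = z) ∧ (∀ i, i ≠ i₀ → s i = z)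
        then ρ (t i₀) (s i₀) else 0) *
      (Matrix.of fun t s : Fin N → Fin d =>
        if t i₀ = s i₀ ∧ ∀ i, i ≠ i₀ → t i = Equiv.swap z (s i₀) (s i) then (1 : ℂ) else 0)ᴴ =
    W * ρ * Wᴴ := by
  set U : Matrix (Fin N → Fin d) (Fin N → Fin d) ℂ := Matrix.of fun t s =>
    if t i₀ = s i₀ ∧ ∀ i, i ≠ i₀ → t i = Equiv.swap z (s i₀) (s i) then (1 : ℂ) else 0 with hU
  let J : Matrix (Fin N → Fin d) (Fin d) ℂ := Matrix.of fun t i =>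
    if t = Function.update (fun _ => z) i₀ i then 1 else 0
  have hupd : ∀ (t : Fin N → Fin d) i, t = Function.update (fun _ => z) i₀ i ↔
      i = t i₀ ∧ ∀ j, j ≠ i₀ → t j = z := by
    intro t i
    rw [Function.eq_update_iff]
    exact and_congr_left' eq_comm
  have hUJ : U * J = W := by
    ext t i
    rw [hW, Matrix.mul_apply]
    simp only [J, Matrix.of_apply, mul_ite, mul_one, mul_zero, Finset.sum_ite_eq',
      Finset.mem_univ, if_true, hU]
    refine if_congr ?_ rfl rfl
    constructor
    · rintro ⟨h1, h2⟩
      funext j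
      by_cases hj : j = i₀
      · subst hj
        simpa using h1
      · simpa [hj] using h2 j hj
    · rintro rfl
      refine ⟨by simp, fun j hj => by simp [hj]⟩
  have hin : (Matrix.of fun t s : Fin N → Fin d =>
      if (∀ i, i ≠ i₀ → t i = z) ∧ (∀ i, i ≠ i₀ → s i = z)
        then ρ (t i₀) (s i₀) else 0) = J * ρ * Jᴴ := by
    ext t s
    simp only [J, Matrix.mul_apply, Matrix.conjTranspose_apply, Matrix.of_apply]
    by_cases ht : ∀ i, i ≠ i₀ → t i = z
    · have ht' : ∀ i, t = Function.update (fun _ => z) i₀ i ↔ i = t i₀ := fun i =>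
        (hupd t i).trans (and_iff_left ht)
      by_cases hs : ∀ i, i ≠ i₀ → s i = z
      · have hs' : ∀ i, s = Function.update (fun _ => z) i₀ i ↔ i = s i₀ := fun i =>
          (hupd s i).trans (and_iff_left hs)
        rw [if_pos ⟨ht, hs⟩]
        simp [ht', hs', apply_ite star]
      · have hs' : ∀ i, s ≠ Function.update (fun _ => z) i₀ i := fun i h =>
          hs ((hupd s i).1 h).2
        rw [if_neg fun h => hs h.2]
        simp [hs']
    · have ht' : ∀ i, t ≠ Function.update (fun _ => z) i₀ i := fun i h =>
        ht ((hupd t i).1 h).2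
      rw [if_neg fun h => ht h.1]
      simp [ht']
  rw [hin, ← hUJ, Matrix.conjTranspose_mul]
  simp only [Matrix.mul_assoc]

/-- Theorem 3: for `f ∈ F⁺_sc`, any state `ρ` on `ℂ^d` and
`ρ' = U(ρ ⊗ (|0⟩⟨0|)^{⊗(N-1)})Uᴴ`, where `U = ∑_i |i⟩⟨i| ⊗ σ_i^{⊗(N-1)}` with
`σ_i` exchanging `|0⟩` and `|i⟩`, one has `E^f_GME(ρ') = G^f_GME(ρ') = C_f(ρ)`. -/
theorem stmt_10 (d N : ℕ) (hd : 2 ≤ d) (hN : 2 ≤ N)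
    (F : SymmConcave) (hF : F.IsPos)
    (ρ : Matrix (Fin d) (Fin d) ℂ) (hρ : ρ.PosSemidef) (htr : ρ.trace = 1) :
    let z : Fin d := ⟨0, by omega⟩
    let i₀ : Fin N := ⟨0, by omega⟩
    let U : Matrix (∀ _ : Fin N, Fin d) (∀ _ : Fin N, Fin d) ℂ :=
      Matrix.of fun t s =>
        if t i₀ = s i₀ ∧ ∀ i, i ≠ i₀ → t i = Equiv.swap z (s i₀) (s i) then 1 else 0
    let ρin : Matrix (∀ _ : Fin N, Fin d) (∀ _ : Fin N, Fin d) ℂ :=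
      Matrix.of fun t s =>
        if (∀ i, i ≠ i₀ → t i = z) ∧ (∀ i, i ≠ i₀ → s i = z)
        then ρ (t i₀) (s i₀) else 0
    let ρ' : Matrix (∀ _ : Fin N, Fin d) (∀ _ : Fin N, Fin d) ℂ := U * ρin * Uᴴ
    convexRoof (EGMEp (dims := fun _ : Fin N => d) F) ρ' = coherenceMeasure F ρ ∧
    convexRoof (GGMEp (dims := fun _ : Fin N => d) F) ρ' = coherenceMeasure F ρ := by
  intro z i₀ U ρin ρ'
  have : Nonempty (Fin N) := ⟨i₀⟩
  have hinj : Function.Injective (fun (i : Fin d) (_ : Fin N) => i) := const_injective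
  have hρ' : ρ' = _ := controlledSwap_conj z i₀ ρ _ rfl
  have hentry : ∀ i j, ρ' (fun _ => i) (fun _ => j) = ρ i j := by
    intro i j
    rw [hρ']
    simp [Matrix.mul_apply, funext_iff, apply_ite star]
  have hl : ∀ t s, t ∉ Set.range (fun (i : Fin d) (_ : Fin N) => i) → ρ' t s = 0 := by
    intro t s ht
    have ht' : ∀ i : Fin d, t ≠ fun _ => i := fun i h => ht ⟨i, h.symm⟩
    rw [hρ']
    simp [Matrix.mul_apply, ht']
  have hr : ∀ t s, s ∉ Set.range (fun (i : Fin d) (_ : Fin N) => i) → ρ' t s = 0 := by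
    intro t s hs
    have hs' : ∀ i : Fin d, s ≠ fun _ => i := fun i h => hs ⟨i, h.symm⟩
    rw [hρ']
    simp [Matrix.mul_apply, hs']
  exact ⟨convexRoof_extend hinj (fun φ _ => EGMEp_ghz hN F φ) hentry hl hr,
    convexRoof_extend hinj (fun φ hφ => GGMEp_ghz hN F hF φ hφ) hentry hl hr⟩
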